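/- arXiv:1904.03218 — 3 statements merged into one kernel-verified Lean document; each statement's English description precedes it below -/
import Mathlib

section
/- Define f : ℝ → ℝ by f(x) = x − e^{−x}(x + x² + x³/2). Then for every x > 0, f(x) = e^{−x} Σ_{k=3}^{∞} x^{k+1}/k! and f(x) ≥ γ · min{x, x⁴}, where γ = f(1) = 1 − 5/(2e). -/
open scoped BigOperators

/-- The probability that a Poisson variable of mean `x` is at least `3`. -/
noncomputable def poissonTail (x : ℝ) : ℝ := 1 - Real.exp (-x) * (1 + x + x ^ 2 / 2)

lemma hasDerivAt_exp_neg (x : ℝ) :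
    HasDerivAt (fun y : ℝ => Real.exp (-y)) (-Real.exp (-x)) x := by
  simpa using (hasDerivAt_neg x).exp

lemma hasDerivAt_poissonTail (x : ℝ) :
    HasDerivAt poissonTail (Real.exp (-x) * (x ^ 2 / 2)) x := by
  have hp : HasDerivAt (fun y : ℝ => 1 + y + y ^ 2 / 2) (1 + x) x := by
    refine (((hasDerivAt_id x).const_add 1).add
      ((hasDerivAt_pow 2 x).div_const 2)).congr_deriv ?_
    norm_num
  refine (((hasDerivAt_exp_neg x).mul hp).const_sub 1).congr_deriv ?_
  ring

lemma monotone_poissonTail : Monotone poissonTail :=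
  monotone_of_hasDerivAt_nonneg hasDerivAt_poissonTail fun x => by
    simp only [Pi.zero_apply]
    positivity

lemma mul_deriv_poissonTail_le {x : ℝ} (hx : 0 ≤ x) :
    x * (Real.exp (-x) * (x ^ 2 / 2)) ≤ 3 * poissonTail x := by
  let k : ℝ → ℝ := fun y => 3 * poissonTail y - Real.exp (-y) * (y ^ 3 / 2)
  have hk (y : ℝ) : HasDerivAt k (Real.exp (-y) * (y ^ 3 / 2)) y := by
    refine (((hasDerivAt_poissonTail y).const_mul 3).sub
      ((hasDerivAt_exp_neg y).mul ((hasDerivAt_pow 3 y).div_const 2))).congr_deriv ?_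
    push_cast
    ring
  have hmono : MonotoneOn k (Set.Ici 0) := by
    refine monotoneOn_of_deriv_nonneg (convex_Ici 0)
      (fun y _ => (hk y).continuousAt.continuousWithinAt)
      (fun y _ => (hk y).differentiableAt.differentiableWithinAt) fun y hy => ?_
    rw [interior_Ici, Set.mem_Ioi] at hy
    rw [(hk y).deriv]
    positivity
  have h := hmono Set.self_mem_Ici hx hx
  simp only [k, poissonTail] at h ⊢
  norm_num at h
  linarith

lemma antitoneOn_poissonTail_div_cube :
    AntitoneOn (fun x => poissonTail x / x ^ 3) (Set.Ioi 0) := by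
  have hd (x : ℝ) (hx : 0 < x) := (hasDerivAt_poissonTail x).div (hasDerivAt_pow 3 x)
    (pow_ne_zero 3 hx.ne')
  refine antitoneOn_of_deriv_nonpos (convex_Ioi 0)
    (fun x hx => (hd x hx).continuousAt.continuousWithinAt)
    (fun x hx => (hd x (interior_subset hx)).differentiableAt.differentiableWithinAt)
    fun x hx => ?_
  rw [interior_Ioi, Set.mem_Ioi] at hx
  refine (hd x hx).deriv.trans_le (div_nonpos_of_nonpos_of_nonneg ?_ (by positivity))
  have h := mul_le_mul_of_nonneg_left (mul_deriv_poissonTail_le hx.le) (sq_nonneg x)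
  push_cast
  linarith

lemma poissonTail_one : poissonTail 1 = 1 - 5 / (2 * Real.exp 1) := by
  rw [poissonTail, Real.exp_neg]
  field_simp
  norm_num

lemma poissonTail_one_mul_min_le {x : ℝ} (hx : 0 < x) :
    poissonTail 1 * min x (x ^ 4) ≤ x * poissonTail x := by
  have hpos : 0 ≤ poissonTail 1 := by
    have h := mul_deriv_poissonTail_le zero_le_one
    have := Real.exp_pos (-1)
    linarith
  rcases le_total 1 x with h | h
  · calc poissonTail 1 * min x (x ^ 4) ≤ poissonTail 1 * x := by
          gcongr
          exact min_le_left _ _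
      _ ≤ poissonTail x * x := by
          gcongr
          exact monotone_poissonTail h
      _ = x * poissonTail x := mul_comm _ _
  · have hq := antitoneOn_poissonTail_div_cube hx (Set.mem_Ioi.2 one_pos) h
    simp only [one_pow, div_one] at hq
    rw [le_div_iff₀ (by positivity)] at hq
    calc poissonTail 1 * min x (x ^ 4) ≤ poissonTail 1 * x ^ 4 := by
          gcongr
          exact min_le_right _ _
      _ = x * (poissonTail 1 * x ^ 3) := by ring
      _ ≤ x * poissonTail x := by gcongr

lemma tsum_pow_div_factorial_add_three (x : ℝ) :
    ∑' k : ℕ, x ^ (k + 3) / ((k + 3).factorial : ℝ) = Real.exp x - (1 + x + x ^ 2 / 2) := by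
  have h := (Real.summable_pow_div_factorial x).sum_add_tsum_nat_add 3
  rw [← congrFun Real.exp_eq_exp_ℝ x |>.trans (congrFun NormedSpace.exp_eq_tsum_div x)] at h
  simp only [Finset.sum_range_succ, Finset.sum_range_zero, Nat.factorial] at h
  norm_num at h
  simp only [Nat.factorial]
  push_cast
  linarith

/-- For `f(x) = x − e^{−x}(x + x² + x³/2)` one has `f(1) = 1 − 5/(2e)`, and
for every `x > 0`, `f(x) = e^{−x} Σ_{k=3}^∞ x^{k+1}/k!` and
`f(x) ≥ (1 − 5/(2e)) · min(x, x⁴)`. -/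
theorem poisson_tail_lower_bound (f : ℝ → ℝ)
    (hf : ∀ x, f x = x - Real.exp (-x) * (x + x ^ 2 + x ^ 3 / 2)) :
    f 1 = 1 - 5 / (2 * Real.exp 1) ∧
    ∀ x : ℝ, 0 < x →
      (f x = Real.exp (-x) * ∑' k : ℕ, x ^ (k + 4) / ((k + 3).factorial : ℝ)) ∧
      f x ≥ (1 - 5 / (2 * Real.exp 1)) * min x (x ^ 4) := by
  have hf' (x : ℝ) : f x = x * poissonTail x := by
    rw [hf, poissonTail]
    ring
  refine ⟨by rw [hf', one_mul, poissonTail_one], fun x hx => ⟨?_, ?_⟩⟩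
  · have hsum : ∑' k : ℕ, x ^ (k + 4) / ((k + 3).factorial : ℝ) =
        x * ∑' k : ℕ, x ^ (k + 3) / ((k + 3).factorial : ℝ) := by
      rw [← tsum_mul_left]
      exact tsum_congr fun k => by ring
    have hexp : Real.exp (-x) * Real.exp x = 1 := by rw [← Real.exp_add]; simp
    rw [hsum, tsum_pow_div_factorial_add_three, hf]
    linear_combination -x * hexp
  · rw [← poissonTail_one, hf']
    exact poissonTail_one_mul_min_le hx
end

section
/- Let C be a finite set with |C| = n ≥ 1, let m > 0 and s ≥ 0 be reals, and let (x_c)_{c∈C} and (b_c)_{c∈C} be families of reals with x_c ≥ 0, Σ_{c∈C} x_c ≤ m, and 0 ≤ b_c ≤ 2 for all c. If Σ_{c∈C} x_c √(b_c) > s, then Σ_{c∈C} min{x_c, x_c⁴} · b_c > min{ s²/(4m), s⁴/(32 n³) }. -/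
open scoped BigOperators

/-- Cauchy–Schwarz for a weighted sum of square roots. -/
theorem sq_sum_mul_sqrt_le {ι : Type*} (S : Finset ι) {x b : ι → ℝ}
    (hx : ∀ i ∈ S, 0 ≤ x i) (hb : ∀ i ∈ S, 0 ≤ b i) :
    (∑ i ∈ S, x i * √(b i)) ^ 2 ≤ (∑ i ∈ S, x i) * ∑ i ∈ S, x i * b i := by
  refine Finset.sum_sq_le_sum_mul_sum_of_sq_le_mul S hx
    (fun i hi => mul_nonneg (hx i hi) (hb i hi)) fun i hi => ?_
  rw [mul_pow, Real.sq_sqrt (hb i hi)]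
  exact (by ring : x i ^ 2 * b i = x i * (x i * b i)).le

/-- The power mean inequality for a weighted sum of square roots with bounded weights. -/
theorem pow_four_sum_mul_sqrt_le {ι : Type*} (S : Finset ι) {x b : ι → ℝ} {B : ℝ}
    (hx : ∀ i ∈ S, 0 ≤ x i) (hb : ∀ i ∈ S, 0 ≤ b i) (hB : ∀ i ∈ S, b i ≤ B) :
    (∑ i ∈ S, x i * √(b i)) ^ 4 ≤ (S.card : ℝ) ^ 3 * (B * ∑ i ∈ S, x i ^ 4 * b i) := by
  have hpow : (∑ i ∈ S, x i * √(b i)) ^ 4 ≤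
      (S.card : ℝ) ^ 3 * ∑ i ∈ S, (x i * √(b i)) ^ 4 :=
    pow_sum_le_card_mul_sum_pow (fun i hi => mul_nonneg (hx i hi) (Real.sqrt_nonneg _)) 3
  refine hpow.trans (mul_le_mul_of_nonneg_left ?_ (by positivity))
  rw [Finset.mul_sum]
  refine Finset.sum_le_sum fun i hi => ?_
  have hsqrt : (x i * √(b i)) ^ 4 = b i * (x i ^ 4 * b i) := by
    rw [mul_pow, show √(b i) ^ 4 = (√(b i) ^ 2) ^ 2 by ring, Real.sq_sqrt (hb i hi)]
    ring
  rw [hsqrt]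
  exact mul_le_mul_of_nonneg_right (hB i hi) (mul_nonneg (by positivity) (hb i hi))

/-- If `x_c ≥ 0` sum to at most `m`, `0 ≤ b_c ≤ 2`, and `Σ x_c √(b_c) > s ≥ 0`,
then `Σ min(x_c, x_c⁴) b_c > min( s²/(4m), s⁴/(32 n³) )` where `n = |C| ≥ 1`. -/
theorem min_pow_weighted_sum_lower_bound {C : Type*} [Fintype C]
    (hn : 1 ≤ Fintype.card C)
    (m s : ℝ) (hm : 0 < m) (hs : 0 ≤ s)
    (x b : C → ℝ)
    (hx : ∀ c, 0 ≤ x c) (hxm : ∑ c, x c ≤ m)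
    (hb0 : ∀ c, 0 ≤ b c) (hb2 : ∀ c, b c ≤ 2)
    (h : ∑ c, x c * Real.sqrt (b c) > s) :
    ∑ c, min (x c) (x c ^ 4) * b c
      > min (s ^ 2 / (4 * m)) (s ^ 4 / (32 * (Fintype.card C : ℝ) ^ 3)) := by
  have hterm : ∀ c, 0 ≤ min (x c) (x c ^ 4) * b c := fun c =>
    mul_nonneg (le_min (hx c) (by have := hx c; positivity)) (hb0 c)
  have hsub : ∀ S : Finset C, ∑ c ∈ S, min (x c) (x c ^ 4) * b c ≤
      ∑ c, min (x c) (x c ^ 4) * b c := fun S =>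
    Finset.sum_le_univ_sum_of_nonneg hterm
  set L := Finset.univ.filter fun c => 1 ≤ x c
  set M := Finset.univ.filter fun c => ¬ 1 ≤ x c
  have hsplit : ∑ c ∈ L, x c * √(b c) + ∑ c ∈ M, x c * √(b c) = ∑ c, x c * √(b c) :=
    Finset.sum_filter_add_sum_filter_not _ _ _
  rw [gt_iff_lt, min_lt_iff]
  by_cases hlarge : s / 2 < ∑ c ∈ L, x c * √(b c)
  · left
    have hmin : ∑ c ∈ L, x c * b c = ∑ c ∈ L, min (x c) (x c ^ 4) * b c := by
      refine Finset.sum_congr rfl fun c hc => ?_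
      rw [min_eq_left (le_self_pow₀ (Finset.mem_filter.mp hc).2 (by norm_num))]
    have hcs := sq_sum_mul_sqrt_le L (fun c _ => hx c) (fun c _ => hb0 c)
    have hLm : ∑ c ∈ L, x c ≤ m := (Finset.sum_le_univ_sum_of_nonneg hx).trans hxm
    have hpos : 0 ≤ ∑ c ∈ L, x c * b c :=
      Finset.sum_nonneg fun c _ => mul_nonneg (hx c) (hb0 c)
    have hlt : (s / 2) ^ 2 < (∑ c ∈ L, x c * √(b c)) ^ 2 :=
      pow_lt_pow_left₀ hlarge (by positivity) (by norm_num)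
    have hle := mul_le_mul_of_nonneg_right hLm hpos
    refine lt_of_lt_of_le ?_ (hmin.le.trans (hsub L))
    rw [div_lt_iff₀ (by positivity)]
    linarith
  · right
    have hsmall : s / 2 < ∑ c ∈ M, x c * √(b c) := by linarith
    have hmin : ∑ c ∈ M, x c ^ 4 * b c = ∑ c ∈ M, min (x c) (x c ^ 4) * b c := by
      refine Finset.sum_congr rfl fun c hc => ?_
      have hc1 : x c ≤ 1 := (not_le.mp (Finset.mem_filter.mp hc).2).le
      rw [min_eq_right (pow_le_of_le_one (hx c) hc1 (by norm_num))]
    have hpm := pow_four_sum_mul_sqrt_le M (fun c _ => hx c) (fun c _ => hb0 c)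
      (fun c _ => hb2 c)
    have hcard : (M.card : ℝ) ^ 3 ≤ (Fintype.card C : ℝ) ^ 3 :=
      pow_le_pow_left₀ (by positivity) (by exact_mod_cast M.card_le_univ) 3
    have hpos : 0 ≤ 2 * ∑ c ∈ M, x c ^ 4 * b c :=
      mul_nonneg (by norm_num) (Finset.sum_nonneg fun c _ =>
        mul_nonneg (pow_nonneg (hx c) 4) (hb0 c))
    have hlt : (s / 2) ^ 4 < (∑ c ∈ M, x c * √(b c)) ^ 4 :=
      pow_lt_pow_left₀ hsmall (by positivity) (by norm_num)
    have hle := mul_le_mul_of_nonneg_right hcard hpos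
    have hcardpos : (0 : ℝ) < Fintype.card C := by exact_mod_cast hn
    refine lt_of_lt_of_le ?_ (hmin.le.trans (hsub M))
    rw [div_lt_iff₀ (by positivity)]
    linarith
end

section
/- There exists an absolute constant R > 0 such that for every λ > 0, if N is a Poisson random variable with parameter λ, then Var[N·1_{N≥4}] ≤ R · E[N·1_{N≥4}]; equivalently, Σ_{k=4}^{∞} k² e^{−λ} λ^k/k! − (Σ_{k=4}^{∞} k e^{−λ} λ^k/k!)² ≤ R · Σ_{k=4}^{∞} k e^{−λ} λ^k/k!. -/
open scoped BigOperators

theorem hasSum_pow_div_factorial_shift (x : ℝ) (m : ℕ) :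
    HasSum (fun n : ℕ => x ^ (n + m) / ((n + m).factorial : ℝ))
      (Real.exp x - ∑ i ∈ Finset.range m, x ^ i / (i.factorial : ℝ)) := by
  refine (hasSum_nat_add_iff' (f := fun n : ℕ => x ^ n / (n.factorial : ℝ)) m).mpr ?_
  rw [Real.exp_eq_exp_ℝ]
  exact NormedSpace.expSeries_div_hasSum_exp x

theorem hasSum_ite_four_le {f g : ℕ → ℝ} {a b : ℝ} (h : HasSum g b)
    (hfg : ∀ n, f (n + 4) = g n) (hab : a = b) :
    HasSum (fun k => if 4 ≤ k then f k else 0) a := by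
  obtain rfl : (fun n => f (n + 4)) = g := funext hfg
  subst hab
  rw [← hasSum_nat_add_iff' 4]
  simpa [Finset.sum_range_succ] using h

theorem hasSum_poisson_truncated_mean (x : ℝ) :
    HasSum (fun k : ℕ => if 4 ≤ k then
        (k : ℝ) * Real.exp (-x) * x ^ k / (k.factorial : ℝ) else 0)
      (x * (1 - Real.exp (-x) * (1 + x + x ^ 2 / 2))) := by
  refine hasSum_ite_four_le
    (f := fun k : ℕ => (k : ℝ) * Real.exp (-x) * x ^ k / (k.factorial : ℝ))
    ((hasSum_pow_div_factorial_shift x 3).mul_left (x * Real.exp (-x))) (fun n => ?_) ?_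
  · have h : ((n + 3).factorial : ℝ) ≠ 0 := by positivity
    rw [Nat.factorial_succ (n + 3)]
    push_cast
    field_simp
    ring
  · have h : Real.exp (-x) * Real.exp x = 1 := by rw [← Real.exp_add]; simp
    simp only [Finset.sum_range_succ, Finset.sum_range_zero, Nat.factorial]
    norm_num
    linear_combination -x * h

theorem hasSum_poisson_truncated_second_moment (x : ℝ) :
    HasSum (fun k : ℕ => if 4 ≤ k then
        (k : ℝ) ^ 2 * Real.exp (-x) * x ^ k / (k.factorial : ℝ) else 0)
      (x ^ 2 * (1 - Real.exp (-x) * (1 + x))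
        + x * (1 - Real.exp (-x) * (1 + x + x ^ 2 / 2))) := by
  refine hasSum_ite_four_le
    (f := fun k : ℕ => (k : ℝ) ^ 2 * Real.exp (-x) * x ^ k / (k.factorial : ℝ))
    (((hasSum_pow_div_factorial_shift x 2).mul_left (x ^ 2 * Real.exp (-x))).add
      ((hasSum_pow_div_factorial_shift x 3).mul_left (x * Real.exp (-x)))) (fun n => ?_) ?_
  · have h : ((n + 2).factorial : ℝ) ≠ 0 := by positivity
    rw [Nat.factorial_succ (n + 3), Nat.factorial_succ (n + 2)]
    push_cast
    field_simp
    ring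
  · have h : Real.exp (-x) * Real.exp x = 1 := by rw [← Real.exp_add]; simp
    simp only [Finset.sum_range_succ, Finset.sum_range_zero, Nat.factorial]
    norm_num
    linear_combination (-x ^ 2 - x) * h

/-- There is an absolute constant `R > 0` such that for every Poisson parameter
`λ > 0`, `Var[N·1_{N≥4}] ≤ R · E[N·1_{N≥4}]`, written out as the corresponding
series: `Σ_{k≥4} k² e^{−λ} λ^k/k! − (Σ_{k≥4} k e^{−λ} λ^k/k!)² ≤
R · Σ_{k≥4} k e^{−λ} λ^k/k!`. -/
theorem poisson_truncated_variance_le :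
    ∃ R : ℝ, 0 < R ∧ ∀ lam : ℝ, 0 < lam →
      (∑' k : ℕ, (if 4 ≤ k then (k : ℝ) ^ 2 * Real.exp (-lam) * lam ^ k / (k.factorial : ℝ) else 0))
        - (∑' k : ℕ, (if 4 ≤ k then (k : ℝ) * Real.exp (-lam) * lam ^ k / (k.factorial : ℝ) else 0)) ^ 2
      ≤ R * ∑' k : ℕ, (if 4 ≤ k then (k : ℝ) * Real.exp (-lam) * lam ^ k / (k.factorial : ℝ) else 0) := by
  refine ⟨7, by norm_num, fun x hx => ?_⟩
  rw [(hasSum_poisson_truncated_second_moment x).tsum_eq,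
    (hasSum_poisson_truncated_mean x).tsum_eq]
  have h : Real.exp (-x) * Real.exp x = 1 := by rw [← Real.exp_add]; simp
  have hpos := Real.exp_pos (-x)
  have hexp : 1 + x + x ^ 2 / 2 + x ^ 3 / 6 ≤ Real.exp x := by
    have h4 := Real.sum_le_exp_of_nonneg hx.le 4
    simp only [Finset.sum_range_succ, Finset.sum_range_zero, Nat.factorial] at h4
    norm_num at h4
    exact h4
  have htail : Real.exp (-x) * x ^ 3 / 6 ≤ 1 - Real.exp (-x) * (1 + x + x ^ 2 / 2) := by
    nlinarith [mul_le_mul_of_nonneg_left hexp hpos.le]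
  have hlow : x * (Real.exp (-x) * (1 + x + x ^ 2 / 2)) ≤ 3 := by
    have hpoly : x * (1 + x + x ^ 2 / 2) ≤ 3 * Real.exp x := by
      nlinarith [sq_nonneg x]
    nlinarith [mul_le_mul_of_nonneg_left hpoly hpos.le]
  set q := 1 - Real.exp (-x) * (1 + x + x ^ 2 / 2) with hq
  have hq0 : 0 ≤ q := le_trans (by positivity) htail
  have hvar : x * (1 - q) ≤ 3 := by simpa [hq] using hlow
  have h1 := mul_le_mul_of_nonneg_left hvar (mul_nonneg hx.le hq0)
  have h2 := mul_le_mul_of_nonneg_left htail hx.le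
  have h3 : 1 - Real.exp (-x) * (1 + x) = q + Real.exp (-x) * x ^ 2 / 2 := by rw [hq]; ring
  rw [h3]
  linarith [h1, h2]
end
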